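/- arXiv:1901.09026 — 3 statements merged into one kernel-verified Lean document; each statement's English description precedes it below -/
import Mathlib

section
/- For every integer k > 0 and every integer j ≥ 0, setting m = (2k+1)j, the following identity of rational numbers holds: C(-1/2, m) · (-1)^m · 4^{3m-j} · ∑_{p=j}^{2m} C(-1/2, p-j) · C(2m, p) = ((8k+4)j)! · j! / ( (2j)! · (((2k+1)j)!)^2 · ((4k+1)j)! ). -/
/-- Generalized binomial coefficient `C(x, n) = x(x-1)⋯(x-n+1)/n!` for `x : ℚ`, `n : ℕ`. -/
def gchoose (x : ℚ) (n : ℕ) : ℚ :=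
  (∏ i ∈ Finset.range n, (x - i)) / (n.factorial : ℚ)

section

open Finset

theorem four_pow_mul_prod_add_half (a n : ℕ) :
    4 ^ n * (∏ i ∈ range n, ((a : ℚ) + i + 1 / 2)) * ((a + n).factorial * (2 * a).factorial)
      = (2 * (a + n)).factorial * a.factorial := by
  induction n with
  | zero => simp [mul_comm]
  | succ n ih =>
    have h : 2 * (a + (n + 1)) = 2 * (a + n) + 1 + 1 := by ring
    rw [prod_range_succ, h, ← add_assoc a n 1, Nat.factorial_succ (a + n),
      Nat.factorial_succ (2 * (a + n) + 1), Nat.factorial_succ (2 * (a + n))]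
    push_cast
    linear_combination (2 * ((a : ℚ) + n) + 2) * (2 * ((a : ℚ) + n) + 1) * ih

theorem gchoose_neg_half (m : ℕ) :
    gchoose (-1/2) m * (-1) ^ m * 4 ^ m = ((2 * m).factorial : ℚ) / (m.factorial : ℚ) ^ 2 := by
  have h := four_pow_mul_prod_add_half 0 m
  have hprod : (∏ i ∈ range m, ((-1/2 : ℚ) - i)) * (-1) ^ m
      = ∏ i ∈ range m, (((0 : ℕ) : ℚ) + i + 1 / 2) := by
    rw [← card_range m, ← prod_const, card_range, ← prod_mul_distrib]
    refine prod_congr rfl fun i _ => ?_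
    push_cast
    ring
  rw [← hprod] at h
  simp only [zero_add, mul_zero, Nat.factorial_zero, Nat.cast_one, mul_one] at h
  rw [gchoose, ← h]
  field_simp

theorem gchoose_sub_half (a n : ℕ) :
    gchoose (((a + n : ℕ) : ℚ) - 1 / 2) n * 4 ^ n
      = ((2 * (a + n)).factorial : ℚ) * a.factorial
        / ((a + n).factorial * (2 * a).factorial * n.factorial) := by
  have hprod : (∏ i ∈ range n, (((a + n : ℕ) : ℚ) - 1 / 2 - i))
      = ∏ i ∈ range n, ((a : ℚ) + i + 1 / 2) := by
    rw [← prod_range_reflect]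
    refine prod_congr rfl fun i hi => ?_
    have hi' : i + 1 ≤ n := mem_range.mp hi
    rw [Nat.sub_sub, add_comm 1 i]
    push_cast [Nat.cast_sub hi']
    ring
  rw [gchoose, hprod, ← four_pow_mul_prod_add_half]
  generalize ∏ i ∈ range n, ((a : ℚ) + i + 1 / 2) = P
  field_simp

theorem ringChoose_eq_gchoose (x : ℚ) (n : ℕ) : Ring.choose x n = gchoose x n := by
  rw [Ring.choose_eq_smul, gchoose, ← descPochhammer_eval_eq_prod_range,
    ← Polynomial.aeval_eq_smeval, Polynomial.aeval_def, Polynomial.eval₂_eq_eval_map,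
    algebraMap_int_eq, descPochhammer_map, smul_eq_mul, div_eq_inv_mul]

/-- Chu–Vandermonde for `gchoose`, with a natural number as one of the two upper indices. -/
theorem sum_gchoose_mul_choose (x : ℚ) (j n : ℕ) :
    ∑ p ∈ Icc j (j + n), gchoose x (p - j) * ((j + n).choose p : ℚ)
      = gchoose (x + (j + n : ℕ)) n := by
  rw [← ringChoose_eq_gchoose, Ring.add_choose_eq n (Commute.all _ _),
    Nat.sum_antidiagonal_eq_sum_range_succ_mk, ← Ico_add_one_right_eq_Icc,
    sum_Ico_eq_sum_range, show j + n + 1 - j = n + 1 by lia]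
  refine sum_congr rfl fun i hi => ?_
  have hi' : i ≤ n := Nat.lt_succ_iff.mp (mem_range.mp hi)
  rw [ringChoose_eq_gchoose, Ring.choose_natCast, Nat.add_sub_cancel_left,
    Nat.choose_symm_of_eq_add (show j + n = (j + i) + (n - i) by lia)]

end

/-- Main combinatorial lemma: for `k > 0` and `j ≥ 0`, with `m = (2k+1)j`,
`C(-1/2, m) (-1)^m 4^{3m-j} ∑_{p=j}^{2m} C(-1/2, p-j) C(2m, p)
  = ((8k+4)j)! j! / ((2j)! ((2k+1)j)!² ((4k+1)j)!)`. -/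
theorem stmt0 (k j : ℕ) (hk : 0 < k) :
    gchoose (-1/2) ((2*k+1)*j) * (-1)^((2*k+1)*j) * 4^(3*((2*k+1)*j) - j) *
      (∑ p ∈ Finset.Icc j (2*((2*k+1)*j)),
        gchoose (-1/2) (p - j) * (Nat.choose (2*((2*k+1)*j)) p : ℚ))
    = ((Nat.factorial ((8*k+4)*j) : ℚ) * (Nat.factorial j : ℚ)) /
      ((Nat.factorial (2*j) : ℚ) * (Nat.factorial ((2*k+1)*j) : ℚ)^2 *
        (Nat.factorial ((4*k+1)*j) : ℚ)) := by
  have hm : 2 * ((2*k+1)*j) = j + (4*k+1)*j := by ring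
  have hexp : 3 * ((2*k+1)*j) - j = (2*k+1)*j + (4*k+1)*j := by
    rw [show 3 * ((2*k+1)*j) = (2*k+1)*j + (4*k+1)*j + j by ring, Nat.add_sub_cancel]
  have h₁ := gchoose_neg_half ((2*k+1)*j)
  have h₂ := gchoose_sub_half j ((4*k+1)*j)
  rw [show (8*k+4)*j = 2 * (j + (4*k+1)*j) by ring, hexp, hm, sum_gchoose_mul_choose, pow_add,
    show (-1/2 : ℚ) + (j + (4*k+1)*j : ℕ) = (j + (4*k+1)*j : ℕ) - 1/2 by ring]
  rw [hm] at h₁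
  calc _ = (gchoose (-1/2) ((2*k+1)*j) * (-1)^((2*k+1)*j) * 4^((2*k+1)*j)) *
        (gchoose (((j + (4*k+1)*j : ℕ) : ℚ) - 1/2) ((4*k+1)*j) * 4^((4*k+1)*j)) := by ring
    _ = _ := by
      rw [h₁, h₂]
      field_simp
end

section
/- Fix an integer k > 0 and α ∈ ℂ with α ≠ 0. Define f_α(u₁, u₂, u₃, u₄) = α·(u₁ + u₂ + u₃ + u₄ - 1) - u₁²·u₂^{2k+1}·u₃^{2k+1}·u₄^{4k+1}. Then there exists a point (u₁, u₂, u₃, u₄) ∈ (ℂ \ {0})⁴ at which f_α and all four partial derivatives ∂f_α/∂u_i vanish simultaneously if and only if α = α_{k,0} = (4k+1)^{4k+1} / ( 4^{8k+3} · (2k+1)^{2(2k+1)} ). -/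
theorem deriv_mul_add_sub_mul_pow (a s c u : ℂ) (n : ℕ) :
    deriv (fun v : ℂ => a * (v + s) - c * v ^ (n + 1)) u = a - c * ((n + 1) * u ^ n) := by
  have h := (((hasDerivAt_id u).add_const s).const_mul a).sub
    ((hasDerivAt_pow (n + 1) u).const_mul c)
  have h' := h.deriv
  simp only [Nat.add_sub_cancel, mul_one, Nat.cast_add, Nat.cast_one] at h'
  exact h'

/-- A partial derivative of the Laurent polynomial vanishes at a nonzero coordinate iff its
logarithmic form does. -/
theorem deriv_mul_add_sub_mul_pow_eq_zero_iff (a s c u : ℂ) (hu : u ≠ 0) (n : ℕ) :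
    deriv (fun v : ℂ => a * (v + s) - c * v ^ (n + 1)) u = 0 ↔
      a * u = (n + 1) * (c * u ^ (n + 1)) := by
  rw [deriv_mul_add_sub_mul_pow, ← mul_left_inj' hu, zero_mul, ← sub_eq_zero (a := a * u)]
  ring_nf

/-- The value of the monomial at the critical point. -/
theorem monomial_at_critical_point (k : ℕ) (n m : ℂ) (hn : n ≠ 0) :
    4 * n * ((1 / (2 * n)) ^ 2 * (1 / 4) ^ (2 * k + 1) * (1 / 4) ^ (2 * k + 1) *
        (m / (4 * n)) ^ (4 * k + 1)) =
      m ^ (4 * k + 1) / (4 ^ (8 * k + 3) * n ^ (2 * (2 * k + 1))) := by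
  have h4 : (4 : ℂ) ^ (8 * k + 3) = 4 ^ (2 * k + 1) * 4 ^ (2 * k + 1) * 4 ^ (4 * k + 1) := by
    rw [← pow_add, ← pow_add]; congr 1; ring
  have hn' : n ^ (2 * (2 * k + 1)) = n * n ^ (4 * k + 1) := by ring
  rw [h4, hn', div_pow, mul_pow, div_pow, div_pow]
  field_simp
  ring

/-- The fibre `W_{k,α} = {f_α = 0} ⊂ (ℂ^×)⁴` has a singular point if and only if
`α = α_{k,0} = (4k+1)^{4k+1} / (4^{8k+3} (2k+1)^{2(2k+1)})`. -/
theorem stmt10 (k : ℕ) (hk : 0 < k) (α : ℂ) (hα : α ≠ 0) :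
    let f : ℂ → ℂ → ℂ → ℂ → ℂ := fun u₁ u₂ u₃ u₄ =>
      α * (u₁ + u₂ + u₃ + u₄ - 1) - u₁^2 * u₂^(2*k+1) * u₃^(2*k+1) * u₄^(4*k+1)
    ((∃ u₁ u₂ u₃ u₄ : ℂ, u₁ ≠ 0 ∧ u₂ ≠ 0 ∧ u₃ ≠ 0 ∧ u₄ ≠ 0 ∧
        f u₁ u₂ u₃ u₄ = 0 ∧
        deriv (fun v => f v u₂ u₃ u₄) u₁ = 0 ∧
        deriv (fun v => f u₁ v u₃ u₄) u₂ = 0 ∧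
        deriv (fun v => f u₁ u₂ v u₄) u₃ = 0 ∧
        deriv (fun v => f u₁ u₂ u₃ v) u₄ = 0)
      ↔ α = ((4*k+1 : ℂ))^(4*k+1) / (4^(8*k+3) * ((2*k+1 : ℂ))^(2*(2*k+1)))) := by
  intro f
  have hn : (2 * k + 1 : ℂ) ≠ 0 := by exact_mod_cast (2 * k).succ_ne_zero
  have hm : (4 * k + 1 : ℂ) ≠ 0 := by exact_mod_cast (4 * k).succ_ne_zero
  have partials (u₁ u₂ u₃ u₄ : ℂ) (h₁ : u₁ ≠ 0) (h₂ : u₂ ≠ 0) (h₃ : u₃ ≠ 0) (h₄ : u₄ ≠ 0)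
      (M : ℂ) (hM : M = u₁^2 * u₂^(2*k+1) * u₃^(2*k+1) * u₄^(4*k+1)) :
      (deriv (fun v => f v u₂ u₃ u₄) u₁ = 0 ↔ α * u₁ = 2 * M) ∧
      (deriv (fun v => f u₁ v u₃ u₄) u₂ = 0 ↔ α * u₂ = (2 * k + 1) * M) ∧
      (deriv (fun v => f u₁ u₂ v u₄) u₃ = 0 ↔ α * u₃ = (2 * k + 1) * M) ∧
      (deriv (fun v => f u₁ u₂ u₃ v) u₄ = 0 ↔ α * u₄ = (4 * k + 1) * M) := by
    refine ⟨?_, ?_, ?_, ?_⟩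
    · convert deriv_mul_add_sub_mul_pow_eq_zero_iff α (u₂ + u₃ + u₄ - 1)
        (u₂^(2*k+1) * u₃^(2*k+1) * u₄^(4*k+1)) u₁ h₁ 1 using 3
      · funext v; simp only [f]; ring
      · push_cast; ring
      · rw [hM]; ring
    · convert deriv_mul_add_sub_mul_pow_eq_zero_iff α (u₁ + u₃ + u₄ - 1)
        (u₁^2 * u₃^(2*k+1) * u₄^(4*k+1)) u₂ h₂ (2*k) using 3
      · funext v; simp only [f]; ring
      · push_cast; ring
      · rw [hM]; ring
    · convert deriv_mul_add_sub_mul_pow_eq_zero_iff α (u₁ + u₂ + u₄ - 1)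
        (u₁^2 * u₂^(2*k+1) * u₄^(4*k+1)) u₃ h₃ (2*k) using 3
      · funext v; simp only [f]; ring
      · push_cast; ring
      · rw [hM]; ring
    · convert deriv_mul_add_sub_mul_pow_eq_zero_iff α (u₁ + u₂ + u₃ - 1)
        (u₁^2 * u₂^(2*k+1) * u₃^(2*k+1)) u₄ h₄ (4*k) using 3
      · funext v; simp only [f]; ring
      · push_cast; ring
  rw [← monomial_at_critical_point k (2 * k + 1) (4 * k + 1) hn]
  constructor
  · rintro ⟨u₁, u₂, u₃, u₄, h₁, h₂, h₃, h₄, hf, d₁, d₂, d₃, d₄⟩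
    obtain ⟨M, hM⟩ : ∃ M, M = u₁^2 * u₂^(2*k+1) * u₃^(2*k+1) * u₄^(4*k+1) := ⟨_, rfl⟩
    obtain ⟨e₁, e₂, e₃, e₄⟩ := partials u₁ u₂ u₃ u₄ h₁ h₂ h₃ h₄ M hM
    rw [e₁] at d₁
    rw [e₂] at d₂
    rw [e₃] at d₃
    rw [e₄] at d₄
    simp only [f, ← hM] at hf
    have hαM : α = 4 * (2 * k + 1) * M := by linear_combination d₁ + d₂ + d₃ + d₄ - hf
    have coord (u c : ℂ) (h : α * u = c * M) : u = c / (4 * (2 * k + 1)) := by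
      have hM0 : M ≠ 0 := by rintro rfl; simp [hαM] at hα
      rw [eq_div_iff (by simpa using hn)]
      apply mul_right_cancel₀ hM0
      linear_combination h - u * hαM
    have v₁ : u₁ = 1 / (2 * (2 * k + 1)) := by
      rw [coord _ _ d₁]; field_simp; norm_num
    have v₂ : u₂ = 1 / 4 := by rw [coord _ _ d₂]; field_simp
    have v₃ : u₃ = 1 / 4 := by rw [coord _ _ d₃]; field_simp
    rw [← v₁, ← v₂, ← coord _ _ d₄]
    nth_rewrite 2 [v₂]
    rw [← v₃, ← hM, hαM]
  · intro hα'
    obtain ⟨M, hM⟩ : ∃ M : ℂ, M = (1 / (2 * (2 * k + 1))) ^ 2 * (1 / 4) ^ (2 * k + 1) *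
      (1 / 4) ^ (2 * k + 1) * ((4 * k + 1) / (4 * (2 * k + 1))) ^ (4 * k + 1) := ⟨_, rfl⟩
    rw [← hM] at hα'
    have h₁ : 1 / (2 * (2 * k + 1) : ℂ) ≠ 0 := by simpa using hn
    have h₂ : (1 / 4 : ℂ) ≠ 0 := by norm_num
    have h₄ : (4 * k + 1 : ℂ) / (4 * (2 * k + 1)) ≠ 0 :=
      div_ne_zero hm (by simpa using hn)
    obtain ⟨e₁, e₂, e₃, e₄⟩ := partials _ _ _ _ h₁ h₂ h₂ h₄ M hM
    refine ⟨_, _, _, _, h₁, h₂, h₂, h₄, ?_, e₁.2 ?_, e₂.2 ?_, e₃.2 ?_, e₄.2 ?_⟩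
    · simp only [f, ← hM]
      rw [hα']; field_simp; ring
    all_goals rw [hα']; field_simp
    norm_num
end

section
/- Fix an integer k > 0 and α ∈ ℂ with α ≠ 0 and α ≠ α_{k,0} = (4k+1)^{4k+1} / ( 4^{8k+3} · (2k+1)^{2(2k+1)} ). Then the polynomial h_{k,α}(t) = t·(4t^{2k+1} + α)·( -64 t^{4k+2} + t^{4k+1} - 32α t^{2k+1} - 4α² ) ∈ ℂ[t] is squarefree; equivalently, it has exactly 6k+4 distinct complex roots. -/
open Polynomial in
theorem separable_of_eval_derivative_ne_zero {p : ℂ[X]}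
    (hp : ∀ t, p.eval t = 0 → p.derivative.eval t ≠ 0) : p.Separable := by
  rw [Polynomial.Separable, isCoprime_iff_aeval_ne_zero_of_isAlgClosed ℂ ℂ]
  intro t
  simpa [or_iff_not_imp_left] using hp t

open Polynomial in
theorem natDegree_branch_polynomial (k : ℕ) (α : ℂ) :
    (X * (4*X^(2*k+1) + C α) *
      (-64*X^(4*k+2) + X^(4*k+1) - 32*C α*X^(2*k+1) - 4*C α^2) : ℂ[X]).natDegree = 6*k+4 := by
  have hA : (4*X^(2*k+1) + C α : ℂ[X]).natDegree = 2*k+1 := by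
    compute_degree!
  have hB : (-64*X^(4*k+2) + X^(4*k+1) - 32*C α*X^(2*k+1) - 4*C α^2 : ℂ[X]).natDegree
      = 4*k+2 := by
    have hne : 4*k+2 ≠ 2*k+1 := by omega
    compute_degree!
    · simp [hne]
    all_goals omega
  have hA0 : (4*X^(2*k+1) + C α : ℂ[X]) ≠ 0 := ne_zero_of_natDegree_gt (n := 0) (by omega)
  have hB0 : (-64*X^(4*k+2) + X^(4*k+1) - 32*C α*X^(2*k+1) - 4*C α^2 : ℂ[X]) ≠ 0 :=
    ne_zero_of_natDegree_gt (n := 0) (by omega)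
  rw [natDegree_mul (mul_ne_zero X_ne_zero hA0) hB0, natDegree_mul X_ne_zero hA0, hA, hB,
    natDegree_X]
  ring

/-- A common zero of `t ^ (4k+1) - 4 (4 t ^ (2k+1) + α) ^ 2` and its derivative forces `α` to be
the critical value. -/
theorem eq_critical_value_of_double_root {k : ℕ} {α t : ℂ} (hα : α ≠ 0)
    (h0 : t^(4*k+1) = 4 * (4*t^(2*k+1) + α)^2)
    (h1 : (4*k+1) * t^(4*k) = 32 * (2*k+1) * (4*t^(2*k+1) + α) * t^(2*k)) :
    α = ((4*k+1 : ℂ))^(4*k+1) / (4^(8*k+3) * ((2*k+1 : ℂ))^(2*(2*k+1))) := by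
  have ht : t ≠ 0 := by
    rintro rfl
    simp [hα] at h0
  have hk1 : (4*k+1 : ℂ) ≠ 0 := by exact_mod_cast (by omega : 4*k+1 ≠ 0)
  have hk2 : (2*k+1 : ℂ) ≠ 0 := by exact_mod_cast (by omega : 2*k+1 ≠ 0)
  have hw : 4*t^(2*k+1) + α ≠ 0 := by
    intro hw
    rw [hw] at h0
    simp [ht] at h0
  have hu : 4*t^(2*k+1) = (4*k+1)*α := by
    have : (4*k+1) * (4*t^(2*k+1) + α) = 8*(2*k+1)*t^(2*k+1) := by
      apply mul_left_cancel₀ (mul_ne_zero (by norm_num : (4 : ℂ) ≠ 0) hw)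
      linear_combination t * h1 - (4*k+1) * h0
    linear_combination -this
  have hp : t^(4*k+1) = 16*(2*k+1)^2*α^2 := by
    rw [h0, hu]
    ring
  have htv : t = (4*k+1)^2 / (4^4 * (2*k+1)^2) := by
    rw [eq_div_iff (mul_ne_zero (by norm_num) (pow_ne_zero 2 hk2))]
    apply mul_left_cancel₀ (pow_ne_zero 2 hα)
    linear_combination -16*t*hp + (4*t^(2*k+1) + (4*k+1)*α) * hu
  have hαu : α = 4*t^(2*k+1) / (4*k+1) := by
    rw [eq_div_iff hk1, hu]
    ring
  rw [hαu, htv, div_pow, mul_pow, ← pow_mul, ← pow_mul, ← pow_mul,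
    show 4*(2*k+1) = (8*k+3)+1 by ring, show 2*(2*k+1) = (4*k+1)+1 by ring,
    pow_succ (4 : ℂ), pow_succ (4*k+1 : ℂ)]
  field_simp

open Polynomial in
/-- For `α ≠ 0` and `α ≠ α_{k,0}` the branch polynomial `h_{k,α}` of the hyperelliptic pencil
is squarefree, i.e. it has exactly `6k+4` distinct complex roots. -/
theorem stmt11 (k : ℕ) (hk : 0 < k) (α : ℂ) (hα : α ≠ 0)
    (hα0 : α ≠ ((4*k+1 : ℂ))^(4*k+1) / (4^(8*k+3) * ((2*k+1 : ℂ))^(2*(2*k+1)))) :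
    let h : ℂ[X] := X * (4*X^(2*k+1) + C α) *
      (-64*X^(4*k+2) + X^(4*k+1) - 32*C α*X^(2*k+1) - 4*C α^2)
    Squarefree h ∧ h.roots.toFinset.card = 6*k+4 := by
  intro h
  have hsep : h.Separable := by
    apply separable_of_eval_derivative_ne_zero
    intro t ht hd
    have hk2 : (2*k+1 : ℂ) ≠ 0 := by exact_mod_cast (by omega : 2*k+1 ≠ 0)
    have hB : -(64*t^(4*k+2)) + t^(4*k+1) - 32*α*t^(2*k+1) - 4*α^2
        = t^(4*k+1) - 4*(4*t^(2*k+1) + α)^2 := by ring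
    simp only [h, eval_mul, eval_add, eval_sub, eval_X, eval_pow, eval_C, eval_neg, eval_ofNat,
      neg_mul, hB, mul_eq_zero] at ht
    simp [h, derivative_pow, hB] at hd
    by_cases ht0 : t = 0
    · subst ht0
      simp [hα] at hd
    by_cases hA : 4*t^(2*k+1) + α = 0
    · simp [hA, ht0, hk2] at hd
    have hB0 := ht.resolve_left (by simp [ht0, hA])
    rw [hB0, mul_zero, zero_add] at hd
    have hd' := (mul_eq_zero.mp hd).resolve_left (mul_ne_zero ht0 hA)
    apply hα0
    apply eq_critical_value_of_double_root (t := t) hα (sub_eq_zero.mp hB0)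
    linear_combination hd'
  refine ⟨hsep.squarefree, ?_⟩
  rw [Multiset.toFinset_card_of_nodup (nodup_roots hsep),
    ← (IsAlgClosed.splits h).natDegree_eq_card_roots]
  exact natDegree_branch_polynomial k α
end
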